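/- For N ≥ 2, m ≥ 1, there is a constant C (depending only on N) such that |g_m'(u)| ≤ C [m(m+N−2)]^{−(N−3)/4} for all u > 0. -/

import Mathlib

open Real

/-- The Bessel function of the first kind of order `ν`, defined by its power series
`J_ν(z) = Σ_{m≥0} (-1)^m z^{2m+ν} / (2^{2m+ν} m! Γ(ν+m+1))`. -/
noncomputable def besselJ (ν : ℝ) (z : ℝ) : ℝ :=
  ∑' m : ℕ, (-1) ^ m * z ^ (2 * (m : ℝ) + ν)
    / (2 ^ (2 * (m : ℝ) + ν) * (Nat.factorial m) * Real.Gamma (ν + m + 1))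

/-- The normalized Bessel function `g_m(u) = 2^{(N-2)/2} Γ(N/2) J_{m+(N-2)/2}(u) / u^{(N-2)/2}`. -/
noncomputable def gBessel (N m : ℕ) (u : ℝ) : ℝ :=
  2 ^ (((N : ℝ) - 2) / 2) * Real.Gamma ((N : ℝ) / 2)
    * besselJ ((m : ℝ) + ((N : ℝ) - 2) / 2) u / u ^ (((N : ℝ) - 2) / 2)

/-- The ratio `Γ(p/2 + 1) / Γ(n + p/2 + 1)`, the inverse of a Pochhammer symbol. -/
noncomputable def invPochhammer (p n : ℕ) : ℝ :=
  Gamma ((p : ℝ) / 2 + 1) / Gamma ((n : ℝ) + (p : ℝ) / 2 + 1)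

/-- The entire function `x ↦ ∑ (-x)^k / (k! (p/2 + 1)_{n+k})`. -/
noncomputable def besselSeries (p n : ℕ) (x : ℝ) : ℝ :=
  ∑' k : ℕ, (-x) ^ k / (k.factorial : ℝ) * invPochhammer p (n + k)

/-- The power series form of `gBessel (p + 2) n`, defined on the whole line. -/
noncomputable def gSeries (p n : ℕ) (u : ℝ) : ℝ :=
  (u / 2) ^ n * besselSeries p n ((u / 2) ^ 2)

lemma invPochhammer_zero (p : ℕ) : invPochhammer p 0 = 1 := by
  have h : 0 < Gamma ((p : ℝ) / 2 + 1) := Gamma_pos_of_pos (by positivity)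
  simp [invPochhammer, h.ne']

lemma invPochhammer_pos (p n : ℕ) : 0 < invPochhammer p n :=
  div_pos (Gamma_pos_of_pos (by positivity)) (Gamma_pos_of_pos (by positivity))

lemma invPochhammer_succ (p n : ℕ) :
    ((n : ℝ) + 1 + (p : ℝ) / 2) * invPochhammer p (n + 1) = invPochhammer p n := by
  have h : 0 < Gamma ((n : ℝ) + (p : ℝ) / 2 + 1) := Gamma_pos_of_pos (by positivity)
  have e : Gamma (((n + 1 : ℕ) : ℝ) + (p : ℝ) / 2 + 1)
      = ((n : ℝ) + (p : ℝ) / 2 + 1) * Gamma ((n : ℝ) + (p : ℝ) / 2 + 1) := by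
    rw [← Gamma_add_one (by positivity)]
    push_cast
    ring_nf
  have hn : (n : ℝ) + (p : ℝ) / 2 + 1 ≠ 0 := by positivity
  rw [invPochhammer, invPochhammer, e]
  field_simp
  ring

lemma invPochhammer_mul_factorial_le_one (p n : ℕ) :
    invPochhammer p n * (n.factorial : ℝ) ≤ 1 := by
  induction n with
  | zero => simp [invPochhammer_zero]
  | succ n ih =>
    refine le_trans ?_ ih
    rw [← invPochhammer_succ p n, Nat.factorial_succ]
    have h : 0 ≤ (p : ℝ) / 2 * (invPochhammer p (n + 1) * (n.factorial : ℝ)) :=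
      mul_nonneg (by positivity) (mul_nonneg (invPochhammer_pos _ _).le (by positivity))
    push_cast
    nlinarith

lemma invPochhammer_add_le (p n k : ℕ) :
    invPochhammer p (n + k) ≤ 1 / (n.factorial : ℝ) := by
  rw [le_div_iff₀ (by positivity)]
  refine le_trans ?_ (invPochhammer_mul_factorial_le_one p (n + k))
  have h : (n.factorial : ℝ) ≤ ((n + k).factorial : ℝ) := by
    exact_mod_cast Nat.factorial_le (Nat.le_add_right n k)
  exact mul_le_mul_of_nonneg_left h (invPochhammer_pos _ _).le

lemma abs_besselSeries_term_le (p n k : ℕ) (x : ℝ) :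
    ‖(-x) ^ k / (k.factorial : ℝ) * invPochhammer p (n + k)‖
      ≤ |x| ^ k / (k.factorial : ℝ) * (1 / (n.factorial : ℝ)) := by
  rw [norm_mul, norm_div, norm_pow, norm_neg, Real.norm_eq_abs, Real.norm_eq_abs,
    Real.norm_eq_abs, abs_of_pos (invPochhammer_pos p (n + k)), Nat.abs_cast]
  exact mul_le_mul_of_nonneg_left (invPochhammer_add_le p n k) (by positivity)

lemma summable_besselSeries (p n : ℕ) (x : ℝ) :
    Summable fun k : ℕ => (-x) ^ k / (k.factorial : ℝ) * invPochhammer p (n + k) :=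
  Summable.of_norm_bounded ((Real.summable_pow_div_factorial |x|).mul_right _)
    (fun k => abs_besselSeries_term_le p n k x)

lemma abs_besselSeries_le (p n : ℕ) (x : ℝ) :
    |besselSeries p n x| ≤ Real.exp |x| / (n.factorial : ℝ) := by
  have h := tsum_of_norm_bounded (((Real.summable_pow_div_factorial |x|).mul_right
    (1 / (n.factorial : ℝ))).hasSum) (fun k => abs_besselSeries_term_le p n k x)
  rw [tsum_mul_right] at h
  rw [Real.exp_eq_exp_ℝ, NormedSpace.exp_eq_tsum_div]
  simpa [besselSeries, div_eq_mul_inv] using h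

lemma hasDerivAt_besselSeries (p n : ℕ) (x : ℝ) :
    HasDerivAt (besselSeries p n) (-besselSeries p (n + 1) x) x := by
  let F : ℕ → ℝ → ℝ := fun k y => (-y) ^ k / (k.factorial : ℝ) * invPochhammer p (n + k)
  let F' : ℕ → ℝ → ℝ := fun k y =>
    ((k : ℝ) * (-y) ^ (k - 1) * (-1)) / (k.factorial : ℝ) * invPochhammer p (n + k)
  have hsucc : ∀ (k : ℕ) (y : ℝ), F' (k + 1) y
      = -((-y) ^ k / (k.factorial : ℝ) * invPochhammer p (n + 1 + k)) := by
    intro k y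
    have e : n + 1 + k = n + (k + 1) := by ring
    simp only [F', Nat.factorial_succ, e, Nat.add_sub_cancel]
    push_cast
    field_simp
  set R : ℝ := |x| + 1 with hR
  have hx : x ∈ Metric.ball (0 : ℝ) R := by simp [hR]
  have hsum : Summable fun k : ℕ => (k : ℝ) * R ^ (k - 1) / (k.factorial : ℝ) := by
    rw [← summable_nat_add_iff 1]
    refine (Real.summable_pow_div_factorial R).congr fun k => ?_
    rw [Nat.factorial_succ, Nat.add_sub_cancel]
    push_cast
    field_simp
  have key : HasDerivAt (fun z => ∑' k, F k z) (∑' k, F' k x) x := by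
    refine hasDerivAt_tsum_of_isPreconnected (t := Metric.ball (0 : ℝ) R) (y₀ := 0)
      hsum Metric.isOpen_ball (convex_ball (0 : ℝ) R).isPreconnected ?_ ?_ ?_
      (summable_besselSeries p n 0) hx
    · intro k y _
      exact ((((hasDerivAt_id y).neg.pow k).div_const _).mul_const _)
    · intro k y hy
      have hy' : |y| ≤ R := by simpa using (mem_ball_zero_iff.1 hy).le
      have h1 : invPochhammer p (n + k) ≤ 1 :=
        (invPochhammer_add_le p n k).trans (by
          rw [div_le_one (by positivity)]
          exact_mod_cast Nat.factorial_pos n)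
      simp only [F', norm_mul, norm_div, norm_pow, norm_neg, Real.norm_eq_abs, Nat.abs_cast,
        abs_one, mul_one, abs_of_pos (invPochhammer_pos p (n + k))]
      calc _ ≤ (k : ℝ) * |y| ^ (k - 1) / (k.factorial : ℝ) * 1 := by gcongr
        _ ≤ _ := by rw [mul_one]; gcongr
    · simp [hR]; positivity
  have hs' : Summable fun k => F' k x := by
    rw [← summable_nat_add_iff 1]
    exact ((summable_besselSeries p (n + 1) x).neg).congr fun k => (hsucc k x).symm
  have hval : ∑' k, F' k x = -besselSeries p (n + 1) x := by
    rw [hs'.tsum_eq_zero_add, besselSeries, ← tsum_neg]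
    simp only [hsucc]
    simp [F']
  rw [← hval]
  exact key

lemma besselSeries_recurrence (p n : ℕ) (x : ℝ) :
    besselSeries p n x + x * besselSeries p (n + 2) x
      = ((n : ℝ) + 1 + (p : ℝ) / 2) * besselSeries p (n + 1) x := by
  have h0 := summable_besselSeries p n x
  have h1 := summable_besselSeries p (n + 1) x
  have h2 := summable_besselSeries p (n + 2) x
  have h3 := invPochhammer_succ p n
  rw [besselSeries, besselSeries, besselSeries, h0.tsum_eq_zero_add, h1.tsum_eq_zero_add,
    mul_add, ← tsum_mul_left, ← tsum_mul_left, add_assoc,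
    ← Summable.tsum_add ((summable_nat_add_iff 1).2 h0) (h2.mul_left x)]
  congr 1
  · simp [h3]
  · refine tsum_congr fun k => ?_
    have h4 := invPochhammer_succ p (n + 1 + k)
    have e1 : n + (k + 1) = n + 1 + k := by ring
    have e2 : n + 1 + (k + 1) = n + 1 + k + 1 := by ring
    have e3 : n + 2 + k = n + 1 + k + 1 := by ring
    rw [e1, e2, e3, ← h4, Nat.factorial_succ, pow_succ]
    push_cast
    field_simp
    ring

lemma gBessel_eq_gSeries (p n : ℕ) {u : ℝ} (hu : 0 < u) :
    gBessel (p + 2) n u = gSeries p n u := by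
  have e1 : (((p + 2 : ℕ) : ℝ) - 2) / 2 = (p : ℝ) / 2 := by push_cast; ring
  have e2 : ((p + 2 : ℕ) : ℝ) / 2 = (p : ℝ) / 2 + 1 := by push_cast; ring
  rw [gBessel, gSeries, besselJ, besselSeries, e1, e2, ← tsum_mul_left, ← tsum_mul_left,
    ← tsum_div_const]
  refine tsum_congr fun k => ?_
  have e3 : 2 * (k : ℝ) + ((n : ℝ) + (p : ℝ) / 2) = ((2 * k + n : ℕ) : ℝ) + (p : ℝ) / 2 := by
    push_cast; ring
  have e4 : (n : ℝ) + (p : ℝ) / 2 + k + 1 = ((n + k : ℕ) : ℝ) + (p : ℝ) / 2 + 1 := by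
    push_cast; ring
  have hG : 0 < Gamma (((n + k : ℕ) : ℝ) + (p : ℝ) / 2 + 1) := Gamma_pos_of_pos (by positivity)
  have hup : 0 < u ^ ((p : ℝ) / 2) := rpow_pos_of_pos hu _
  have h2p : 0 < (2 : ℝ) ^ ((p : ℝ) / 2) := by positivity
  rw [e3, e4, rpow_add hu, rpow_add two_pos, rpow_natCast, rpow_natCast, invPochhammer,
    neg_pow ((u / 2) ^ 2) k, ← pow_mul, div_pow, div_pow]
  field_simp
  ring

lemma hasDerivAt_half_pow_succ (n : ℕ) (u : ℝ) :
    HasDerivAt (fun u : ℝ => (u / 2) ^ (n + 1)) (((n : ℝ) + 1) * (u / 2) ^ n * (1 / 2)) u := by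
  refine (((hasDerivAt_id u).div_const 2).pow (n + 1)).congr_deriv ?_
  simp

lemma hasDerivAt_gSeries_zero (p : ℕ) (u : ℝ) :
    HasDerivAt (gSeries p 0) (-gSeries p 1 u) u := by
  have hx := hasDerivAt_half_pow_succ 1 u
  have h := (hasDerivAt_besselSeries p 0 ((u / 2) ^ 2)).comp u hx
  have e : gSeries p 0 = besselSeries p 0 ∘ fun u : ℝ => (u / 2) ^ 2 := by
    ext; simp [gSeries]
  rw [e]
  refine h.congr_deriv ?_
  simp only [gSeries]
  push_cast
  ring

lemma hasDerivAt_gSeries_succ (p n : ℕ) (u : ℝ) :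
    HasDerivAt (gSeries p (n + 1))
      (((n : ℝ) + 1) / (2 * (n + 1) + p) * gSeries p n u
        - ((n : ℝ) + 1 + p) / (2 * (n + 1) + p) * gSeries p (n + 2) u) u := by
  have hx := hasDerivAt_half_pow_succ 1 u
  have hp := hasDerivAt_half_pow_succ n u
  have h := hp.mul ((hasDerivAt_besselSeries p (n + 1) ((u / 2) ^ 2)).comp u hx)
  have hr := besselSeries_recurrence p n ((u / 2) ^ 2)
  have hD : (2 * ((n : ℝ) + 1) + p) ≠ 0 := by positivity
  have hr' : besselSeries p (n + 1) ((u / 2) ^ 2) = 2 / (2 * ((n : ℝ) + 1) + p) *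
      (besselSeries p n ((u / 2) ^ 2)
        + (u / 2) ^ 2 * besselSeries p (n + 2) ((u / 2) ^ 2)) := by
    rw [hr]; field_simp
  refine (h.congr_deriv ?_)
  simp only [gSeries, Function.comp_apply, hr']
  field_simp
  ring

lemma choose_succ_mul (p n : ℕ) :
    ((n + 1 + p).choose p : ℝ) * (n + 1) = ((n + p).choose p : ℝ) * (n + 1 + p) := by
  have h := Nat.add_one_mul_choose_eq (n + p) n
  have e1 : (n + p).choose n = (n + p).choose p := by
    rw [Nat.choose_symm_add]
  have e2 : (n + p).succ.choose n.succ = (n + 1 + p).choose p := by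
    have : (n + p).succ = (n + 1) + p := by omega
    rw [this, Nat.succ_eq_add_one, Nat.choose_symm_add]
  rw [e1, e2] at h
  have h' : (((n + p).succ * (n + p).choose p : ℕ) : ℝ)
      = (((n + 1 + p).choose p * n.succ : ℕ) : ℝ) := by rw [h]
  push_cast at h'
  linarith

/-- The dimension of the space of spherical harmonics of degree `n` on the sphere of
dimension `p + 1`. -/
noncomputable def harmonicDim (p : ℕ) : ℕ → ℝ
  | 0 => 1
  | n + 1 => ((n + 1 + p).choose p : ℝ) + ((n + p).choose p : ℝ)

lemma harmonicDim_nonneg (p n : ℕ) : 0 ≤ harmonicDim p n := by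
  cases n <;> simp only [harmonicDim] <;> positivity

lemma pow_le_factorial_mul_harmonicDim (p n : ℕ) :
    ((n : ℝ) + 1) ^ p ≤ (p.factorial : ℝ) * harmonicDim p n := by
  cases n with
  | zero =>
    simp only [harmonicDim, Nat.cast_zero, zero_add, one_pow, mul_one]
    exact_mod_cast Nat.factorial_pos p
  | succ n =>
    have h : ((n + 1 + 1 : ℕ)) ^ p ≤ p.factorial * (n + 1 + p).choose p := by
      have := Nat.pow_sub_le_descFactorial (n + 1 + p) p
      rw [Nat.descFactorial_eq_factorial_mul_choose] at this
      convert this using 2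
      omega
    have h' : ((n + 1 : ℕ) + 1 : ℝ) ^ p ≤ (p.factorial : ℝ) * ((n + 1 + p).choose p : ℝ) := by
      exact_mod_cast h
    refine h'.trans ?_
    simp only [harmonicDim]
    gcongr
    linarith [(Nat.cast_nonneg ((n + p).choose p) : (0 : ℝ) ≤ _)]

lemma hasDerivAt_sum_harmonicDim_mul_sq (p K : ℕ) (u : ℝ) :
    HasDerivAt (fun u => ∑ n ∈ Finset.range (K + 1), harmonicDim p n * gSeries p n u ^ 2)
      (-2 * ((K + p).choose p : ℝ) * (gSeries p K u * gSeries p (K + 1) u)) u := by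
  induction K with
  | zero =>
    simp only [zero_add, Finset.sum_range_one, harmonicDim, Nat.choose_self, one_mul]
    refine ((hasDerivAt_gSeries_zero p u).pow 2).congr_deriv ?_
    push_cast
    ring
  | succ K ih =>
    have e : (fun u => ∑ n ∈ Finset.range (K + 1 + 1), harmonicDim p n * gSeries p n u ^ 2)
        = fun u => (∑ n ∈ Finset.range (K + 1), harmonicDim p n * gSeries p n u ^ 2)
          + harmonicDim p (K + 1) * gSeries p (K + 1) u ^ 2 := by
      ext; rw [Finset.sum_range_succ]
    rw [e]
    refine (ih.add (((hasDerivAt_gSeries_succ p K u).pow 2).const_mul _)).congr_deriv ?_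
    have hq := choose_succ_mul p K
    have hD : (2 * ((K : ℝ) + 1) + p) ≠ 0 := by positivity
    have ha : harmonicDim p (K + 1) * (((K : ℝ) + 1) / (2 * (K + 1) + p))
        = ((K + p).choose p : ℝ) := by
      simp only [harmonicDim]; field_simp; linarith
    have hb : harmonicDim p (K + 1) * (((K : ℝ) + 1 + p) / (2 * (K + 1) + p))
        = ((K + 1 + p).choose p : ℝ) := by
      simp only [harmonicDim]; field_simp; linarith
    rw [← ha, ← hb]
    push_cast
    ring

lemma abs_gSeries_le (p n : ℕ) {u v : ℝ} (hv : 0 ≤ v) (hvu : v ≤ u) :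
    |gSeries p n v| ≤ (u / 2) ^ n / (n.factorial : ℝ) * Real.exp ((u / 2) ^ 2) := by
  have h := abs_besselSeries_le p n ((v / 2) ^ 2)
  rw [abs_of_nonneg (by positivity : 0 ≤ (v / 2) ^ 2)] at h
  have hu : 0 ≤ u := hv.trans hvu
  rw [gSeries, abs_mul, abs_of_nonneg (by positivity : 0 ≤ (v / 2) ^ n)]
  calc _ ≤ (v / 2) ^ n * (Real.exp ((v / 2) ^ 2) / (n.factorial : ℝ)) := by gcongr
    _ ≤ (u / 2) ^ n * (Real.exp ((u / 2) ^ 2) / (n.factorial : ℝ)) := by gcongr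
    _ = _ := by ring

lemma sum_harmonicDim_mul_sq_zero (p K : ℕ) :
    ∑ n ∈ Finset.range (K + 1), harmonicDim p n * gSeries p n 0 ^ 2 = 1 := by
  have h0 : besselSeries p 0 0 = 1 := by
    rw [besselSeries, tsum_eq_single 0 (fun k hk => by simp [hk])]
    simp [invPochhammer_zero]
  rw [Finset.sum_range_succ', Finset.sum_eq_zero (fun n _ => by simp [gSeries])]
  simp [gSeries, harmonicDim, h0]

lemma sum_harmonicDim_mul_sq_le (p K : ℕ) {u : ℝ} (hu : 0 ≤ u) :
    ∑ n ∈ Finset.range (K + 1), harmonicDim p n * gSeries p n u ^ 2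
      ≤ 1 + 2 * ((2 : ℝ) ^ (K + p) * ((u / 2) ^ K / (K.factorial : ℝ) * Real.exp ((u / 2) ^ 2))
        * ((u / 2) ^ (K + 1) / ((K + 1).factorial : ℝ) * Real.exp ((u / 2) ^ 2))) * u := by
  have hd := hasDerivAt_sum_harmonicDim_mul_sq p K
  have h := (convex_Icc (0 : ℝ) u).norm_image_sub_le_of_norm_hasDerivWithin_le
    (fun v _ => (hd v).hasDerivWithinAt) (C := 2 * ((2 : ℝ) ^ (K + p) *
      ((u / 2) ^ K / (K.factorial : ℝ) * Real.exp ((u / 2) ^ 2)) *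
      ((u / 2) ^ (K + 1) / ((K + 1).factorial : ℝ) * Real.exp ((u / 2) ^ 2)))) ?_
    (Set.left_mem_Icc.2 hu) (Set.right_mem_Icc.2 hu)
  · rw [sum_harmonicDim_mul_sq_zero, Real.norm_eq_abs, Real.norm_eq_abs, sub_zero,
      abs_of_nonneg hu] at h
    linarith [le_abs_self (∑ n ∈ Finset.range (K + 1),
      harmonicDim p n * gSeries p n u ^ 2 - 1)]
  · intro v hv
    have hc : ((K + p).choose p : ℝ) ≤ 2 ^ (K + p) := by
      exact_mod_cast Nat.choose_le_two_pow (K + p) p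
    have h1 := abs_gSeries_le p K hv.1 hv.2
    have h2 := abs_gSeries_le p (K + 1) hv.1 hv.2
    rw [Real.norm_eq_abs, abs_mul, abs_mul, abs_mul, Nat.abs_cast, abs_neg, abs_two, mul_assoc,
      ← mul_assoc ((K + p).choose p : ℝ)]
    gcongr

lemma harmonicDim_mul_gSeries_sq_le_one (p n : ℕ) {u : ℝ} (hu : 0 ≤ u) :
    harmonicDim p n * gSeries p n u ^ 2 ≤ 1 := by
  have hA : Filter.Tendsto (fun K : ℕ => u ^ K / (K.factorial : ℝ)) Filter.atTop (nhds 0) :=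
    FloorSemiring.tendsto_pow_div_factorial_atTop u
  have hB : Filter.Tendsto (fun K : ℕ => (u / 2) ^ (K + 1) / ((K + 1).factorial : ℝ))
      Filter.atTop (nhds 0) :=
    (FloorSemiring.tendsto_pow_div_factorial_atTop (u / 2)).comp (Filter.tendsto_add_atTop_nat 1)
  have hlim : Filter.Tendsto (fun K : ℕ => 1 + 2 * ((2 : ℝ) ^ (K + p) *
      ((u / 2) ^ K / (K.factorial : ℝ) * Real.exp ((u / 2) ^ 2)) *
      ((u / 2) ^ (K + 1) / ((K + 1).factorial : ℝ) * Real.exp ((u / 2) ^ 2))) * u)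
      Filter.atTop (nhds 1) := by
    have h := ((hA.mul hB).mul_const
      (2 * 2 ^ p * Real.exp ((u / 2) ^ 2) * Real.exp ((u / 2) ^ 2) * u)).const_add 1
    simp only [mul_zero, zero_mul, add_zero] at h
    refine h.congr fun K => ?_
    rw [pow_add 2 K p, div_pow u 2 K]
    field_simp
  refine ge_of_tendsto hlim ?_
  filter_upwards [Filter.eventually_ge_atTop n] with K hK
  refine le_trans ?_ (sum_harmonicDim_mul_sq_le p K hu)
  exact Finset.single_le_sum (f := fun n => harmonicDim p n * gSeries p n u ^ 2)
    (fun i _ => mul_nonneg (harmonicDim_nonneg p i) (sq_nonneg _))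
    (Finset.mem_range.2 (Nat.lt_succ_of_le hK))

lemma abs_gSeries_le_of_pow_le (p n : ℕ) {a u : ℝ} (ha : 0 < a) (han : a ≤ n + 1)
    (hu : 0 ≤ u) : |gSeries p n u| ≤ √(p.factorial : ℝ) * a ^ (-(p : ℝ) / 2) := by
  have h1 := harmonicDim_mul_gSeries_sq_le_one p n hu
  have h2 := pow_le_factorial_mul_harmonicDim p n
  have h3 : a ^ p ≤ ((n : ℝ) + 1) ^ p := by gcongr
  have h4 : a ^ p * gSeries p n u ^ 2 ≤ (p.factorial : ℝ) := by
    calc _ ≤ ((p.factorial : ℝ) * harmonicDim p n) * gSeries p n u ^ 2 := by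
          gcongr; exact h3.trans h2
      _ = (p.factorial : ℝ) * (harmonicDim p n * gSeries p n u ^ 2) := by ring
      _ ≤ (p.factorial : ℝ) * 1 := by gcongr
      _ = _ := mul_one _
  have h5 : (a ^ (-(p : ℝ) / 2)) ^ 2 * a ^ p = 1 := by
    rw [← rpow_natCast, ← rpow_natCast, ← rpow_mul ha.le, ← rpow_add ha]
    push_cast
    rw [show -(p : ℝ) / 2 * 2 + p = 0 by ring, rpow_zero]
  refine abs_le_of_sq_le_sq ?_ (by positivity)
  rw [mul_pow, Real.sq_sqrt (by positivity)]
  calc gSeries p n u ^ 2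
      = (a ^ (-(p : ℝ) / 2)) ^ 2 * (a ^ p * gSeries p n u ^ 2) := by
        rw [← mul_assoc, h5, one_mul]
    _ ≤ (a ^ (-(p : ℝ) / 2)) ^ 2 * (p.factorial : ℝ) := by gcongr
    _ = _ := mul_comm _ _

lemma abs_deriv_gBessel_le (p n : ℕ) {u : ℝ} (hu : 0 < u) :
    |deriv (gBessel (p + 2) (n + 1)) u| ≤ |gSeries p n u| + |gSeries p (n + 2) u| := by
  have he : gBessel (p + 2) (n + 1) =ᶠ[nhds u] gSeries p (n + 1) := by
    filter_upwards [lt_mem_nhds hu] with v hv using gBessel_eq_gSeries p (n + 1) hv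
  rw [he.deriv_eq, (hasDerivAt_gSeries_succ p n u).deriv]
  have ha : ((n : ℝ) + 1) / (2 * (n + 1) + p) ≤ 1 := by
    rw [div_le_one (by positivity)]
    linarith [(Nat.cast_nonneg n : (0 : ℝ) ≤ n), (Nat.cast_nonneg p : (0 : ℝ) ≤ p)]
  have hb : ((n : ℝ) + 1 + p) / (2 * (n + 1) + p) ≤ 1 := by
    rw [div_le_one (by positivity)]
    linarith [(Nat.cast_nonneg n : (0 : ℝ) ≤ n)]
  simp only [← Real.norm_eq_abs]
  refine (norm_sub_le _ _).trans ?_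
  rw [norm_mul, norm_mul,
    Real.norm_of_nonneg (by positivity : 0 ≤ ((n : ℝ) + 1) / (2 * (n + 1) + p)),
    Real.norm_of_nonneg (by positivity : 0 ≤ ((n : ℝ) + 1 + p) / (2 * (n + 1) + p))]
  exact add_le_add (mul_le_of_le_one_left (norm_nonneg _) ha)
    (mul_le_of_le_one_left (norm_nonneg _) hb)

lemma rpow_neg_half_le (p : ℕ) {a : ℝ} (ha : 1 ≤ a) :
    a ^ (-(p : ℝ) / 2)
      ≤ ((p : ℝ) + 1) ^ ((p : ℝ) / 4) * (a * (a + p)) ^ (-((p : ℝ) - 1) / 4) := by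
  have hp : (0 : ℝ) ≤ p := Nat.cast_nonneg p
  have ha0 : 0 < a := by linarith
  have hM1 : 1 ≤ a * (a + p) := by nlinarith
  have hM : a * (a + p) ≤ (p + 1) * a ^ 2 := by nlinarith [mul_nonneg hp (sub_nonneg.2 ha)]
  have h1 : ((p + 1) * a ^ 2 : ℝ) ^ (-((p : ℝ) / 4)) ≤ (a * (a + p)) ^ (-((p : ℝ) / 4)) :=
    rpow_le_rpow_of_nonpos (by positivity) hM (by linarith)
  have h2 : (a * (a + p)) ^ (-((p : ℝ) / 4)) ≤ (a * (a + p)) ^ (-((p : ℝ) - 1) / 4) :=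
    rpow_le_rpow_of_exponent_le hM1 (by linarith)
  have h3 : a ^ (-(p : ℝ) / 2)
      = ((p : ℝ) + 1) ^ ((p : ℝ) / 4) * ((p + 1) * a ^ 2 : ℝ) ^ (-((p : ℝ) / 4)) := by
    rw [mul_rpow (by positivity) (by positivity), ← mul_assoc, ← rpow_add (by positivity),
      add_neg_cancel, rpow_zero, one_mul, ← rpow_natCast, ← rpow_mul ha0.le]
    congr 1
    push_cast
    ring
  rw [h3]
  gcongr
  exact h1.trans h2

/-- For `N ≥ 2` there is `C > 0` such that for all `m ≥ 1` and `u > 0`,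
`|g_m'(u)| ≤ C [m(m+N−2)]^{−(N−3)/4}`. -/
theorem gBessel_deriv_bound (N : ℕ) (hN : 2 ≤ N) :
    ∃ C : ℝ, 0 < C ∧ ∀ m : ℕ, 1 ≤ m → ∀ u : ℝ, 0 < u →
      |deriv (gBessel N m) u|
        ≤ C * ((m : ℝ) * ((m : ℝ) + (N : ℝ) - 2)) ^ (-((N : ℝ) - 3) / 4) := by
  obtain ⟨p, rfl⟩ := Nat.exists_eq_add_of_le' hN
  refine ⟨2 * √(p.factorial : ℝ) * ((p : ℝ) + 1) ^ ((p : ℝ) / 4), by positivity, ?_⟩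
  intro m hm u hu
  obtain ⟨n, rfl⟩ := Nat.exists_eq_add_of_le' hm
  have h1 := abs_gSeries_le_of_pow_le p n (a := (n : ℝ) + 1) (by positivity) le_rfl hu.le
  have h2 := abs_gSeries_le_of_pow_le p (n + 2) (a := (n : ℝ) + 1) (by positivity)
    (by push_cast; linarith) hu.le
  have h3 := rpow_neg_half_le p (a := (n : ℝ) + 1) (by
    linarith [(Nat.cast_nonneg n : (0 : ℝ) ≤ n)])
  have e1 : ((n + 1 : ℕ) : ℝ) + ((p + 2 : ℕ) : ℝ) - 2 = (n : ℝ) + 1 + p := by push_cast; ring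
  have e2 : -(((p + 2 : ℕ) : ℝ) - 3) / 4 = -((p : ℝ) - 1) / 4 := by push_cast; ring
  rw [e1, e2, Nat.cast_add_one]
  calc _ ≤ |gSeries p n u| + |gSeries p (n + 2) u| := abs_deriv_gBessel_le p n hu
    _ ≤ 2 * √(p.factorial : ℝ) * ((n : ℝ) + 1) ^ (-(p : ℝ) / 2) := by linarith
    _ ≤ 2 * √(p.factorial : ℝ) * (((p : ℝ) + 1) ^ ((p : ℝ) / 4)
          * (((n : ℝ) + 1) * ((n : ℝ) + 1 + p)) ^ (-((p : ℝ) - 1) / 4)) := by gcongr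
    _ = _ := by ring
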